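/- arXiv:1510.00728 — 2 statements merged into one kernel-verified Lean document; each statement's English description precedes it below -/
import Mathlib

section
/- Monotonicity of R_w: let w be a positive word in n letters. If sᵢ ≥ sᵢ' for all i = 1, …, n, then R_w(s₁,…,sₙ) ≥ R_w(s₁',…,sₙ'). -/
open CircleDeg1Lift

/-- Translation number of an element of `Homeo_ℤ(ℝ) = CircleDeg1Liftˣ`. -/
noncomputable def tau (f : CircleDeg1Liftˣ) : ℝ :=
  translationNumber (f : CircleDeg1Lift)

/-- The set of translation numbers `τ(w(f₁,…,fₙ))` over all tuples `fᵢ ∈ Homeo_ℤ(ℝ)`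
with `τ(fᵢ) = sᵢ`. -/
def rotSet {n : ℕ} (w : FreeMonoid (Fin n)) (s : Fin n → ℝ) : Set ℝ :=
  {y | ∃ f : Fin n → CircleDeg1Liftˣ, (∀ i, tau (f i) = s i) ∧ y = tau (FreeMonoid.lift f w)}

/-- `R_w(s₁,…,sₙ) = sup { τ(w(f₁,…,fₙ)) : τ(fᵢ) = sᵢ }`. -/
noncomputable def Rw {n : ℕ} (w : FreeMonoid (Fin n)) (s : Fin n → ℝ) : ℝ :=
  sSup (rotSet w s)

/-- The translation number of `x ↦ t + f x` depends continuously on `t`. -/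
theorem continuous_tau_translate_mul (f : CircleDeg1Liftˣ) :
    Continuous fun t : ℝ => tau (translate (Multiplicative.ofAdd t) * f) := by
  set F : ℝ → CircleDeg1Lift := fun t =>
    (translate (Multiplicative.ofAdd t) * f : CircleDeg1Liftˣ) with hF
  have hf : Continuous (f : CircleDeg1Lift) := (toOrderIso f).continuous
  have hpow : ∀ n : ℕ, Continuous fun t : ℝ => (F t ^ n) 0 := by
    intro n
    induction n with
    | zero => simpa using continuous_const
    | succ n ih =>
      have h : (fun t : ℝ => (F t ^ (n + 1)) 0) =
          fun t : ℝ => t + (f : CircleDeg1Lift) ((F t ^ n) 0) := by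
        funext t
        rw [pow_succ', mul_apply]
        simp [hF]
      rw [h]
      exact continuous_id.add (hf.comp ih)
  have hlim : TendstoUniformly (fun (n : ℕ) (t : ℝ) => (F t ^ (n + 1)) 0 / ((n : ℝ) + 1))
      (fun t => translationNumber (F t)) Filter.atTop := by
    rw [Metric.tendstoUniformly_iff]
    intro ε hε
    filter_upwards [(tendsto_one_div_add_atTop_nhds_zero_nat (𝕜 := ℝ)).eventually_lt_const hε]
      with n hn t
    refine lt_of_le_of_lt ?_ hn
    have hpos : (0 : ℝ) < (n : ℝ) + 1 := by positivity
    have h := (F t).dist_pow_map_zero_mul_translationNumber_le (n + 1)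
    rw [Real.dist_eq, abs_le] at h
    push_cast at h
    rw [dist_comm, Real.dist_eq, div_sub' hpos.ne', abs_div, abs_of_pos hpos]
    gcongr
    exact abs_le.2 h
  exact hlim.continuous (Filter.Frequently.of_forall fun n => (hpow (n + 1)).div_const _)

/-- An element of `Homeo_ℤ(ℝ)` lies below an element of any prescribed larger
translation number. -/
theorem exists_le_tau_eq (f : CircleDeg1Liftˣ) {s : ℝ} (hs : tau f ≤ s) :
    ∃ g : CircleDeg1Liftˣ, (f : CircleDeg1Lift) ≤ g ∧ tau g = s := by
  obtain ⟨n, hn⟩ := exists_nat_ge (s - tau f)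
  have h0 : tau (translate (Multiplicative.ofAdd (0 : ℝ)) * f) = tau f := by simp
  have hcomm : Commute ((translate (Multiplicative.ofAdd (n : ℝ)) : CircleDeg1Liftˣ) :
      CircleDeg1Lift) f := by
    ext x
    simp
  have h1 : tau (translate (Multiplicative.ofAdd (n : ℝ)) * f) = n + tau f := by
    simp only [tau, Units.val_mul]
    rw [translationNumber_mul_of_commute hcomm, translationNumber_translate]
  obtain ⟨t, ht, hts⟩ := intermediate_value_Icc (Nat.cast_nonneg n)
    (continuous_tau_translate_mul f).continuousOn
    (show s ∈ Set.Icc _ _ from ⟨h0.le.trans hs, by rw [h1]; linarith⟩)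
  refine ⟨_, fun x => ?_, hts⟩
  simpa using ht.1

/-- Evaluation of a positive word is monotone in the substituted homeomorphisms. -/
theorem lift_le_lift {α : Type*} {f g : α → CircleDeg1Liftˣ}
    (h : ∀ i, (f i : CircleDeg1Lift) ≤ g i) (w : FreeMonoid α) :
    (FreeMonoid.lift f w : CircleDeg1Lift) ≤ FreeMonoid.lift g w := by
  induction w using FreeMonoid.inductionOn' with
  | one => simp
  | of_mul i w ih =>
    intro x
    simp only [map_mul, FreeMonoid.lift_eval_of, Units.val_mul, mul_apply]
    exact (h i _).trans ((g i : CircleDeg1Lift).mono (ih x))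

theorem rotSet_nonempty {n : ℕ} (w : FreeMonoid (Fin n)) (s : Fin n → ℝ) :
    (rotSet w s).Nonempty :=
  ⟨_, fun i => translate (Multiplicative.ofAdd (s i)),
    fun i => translationNumber_translate (s i), rfl⟩

theorem rotSet_bddAbove {n : ℕ} (w : FreeMonoid (Fin n)) (s : Fin n → ℝ) :
    BddAbove (rotSet w s) := by
  obtain ⟨C, hC⟩ : ∃ C : ℝ, ∀ f : Fin n → CircleDeg1Liftˣ, (∀ i, tau (f i) = s i) →
      ∀ x, (FreeMonoid.lift f w : CircleDeg1Lift) x ≤ x + C := by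
    induction w using FreeMonoid.inductionOn' with
    | one => exact ⟨0, fun f _ x => by simp⟩
    | of_mul i w ih =>
      obtain ⟨C, hC⟩ := ih
      refine ⟨C + s i + 1, fun f hf x => ?_⟩
      simp only [map_mul, FreeMonoid.lift_eval_of, Units.val_mul, mul_apply]
      have h1 := (f i : CircleDeg1Lift).map_lt_add_translationNumber_add_one
        ((FreeMonoid.lift f w : CircleDeg1Lift) x)
      have h2 := hC f hf x
      have h3 : translationNumber (f i : CircleDeg1Lift) = s i := hf i
      linarith
  refine ⟨C, ?_⟩
  rintro _ ⟨f, hf, rfl⟩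
  exact translationNumber_le_of_le_add _ (hC f hf)

/-- Monotonicity of `R_w`: if `sᵢ ≥ sᵢ'` for all `i`, then
`R_w(s₁,…,sₙ) ≥ R_w(s₁',…,sₙ')`. -/
theorem Rw_monotone {n : ℕ} (w : FreeMonoid (Fin n)) (hw : w ≠ 1)
    (s s' : Fin n → ℝ) (hss' : ∀ i, s' i ≤ s i) :
    Rw w s' ≤ Rw w s := by
  refine csSup_le (rotSet_nonempty w s') ?_
  rintro _ ⟨f, hf, rfl⟩
  choose g hfg hg using fun i => exists_le_tau_eq (f i) ((hf i).trans_le (hss' i))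
  exact (translationNumber_mono (lift_le_lift hfg w)).trans
    (le_csSup (rotSet_bddAbove w s) ⟨g, hg, rfl⟩)
end

section
/- The Calegari–Walker formula for products: for all s, t ∈ ℝ, the supremum R_{fg}(s,t) := sup { τ(f∘g) : f, g ∈ Homeo_ℤ(ℝ), τ(f) = s, τ(g) = t } equals sup { (p₁ + p₂ + 1)/q : p₁, p₂, q ∈ ℤ, q > 0, p₁/q ≤ s, p₂/q ≤ t }. -/
open CircleDeg1Lift

theorem map_mul_of_map_add_eq_add_one {F : ℤ → ℝ} {n : ℤ} (hF : ∀ j, F (j + n) = F j + 1)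
    (k : ℤ) : F (k * n) = F 0 + k := by
  induction k using Int.induction_on with
  | zero => simp
  | succ k ih =>
    rw [show ((k : ℤ) + 1) * n = k * n + n by ring, hF, ih]; push_cast; ring
  | pred k ih =>
    have := hF ((-(k : ℤ) - 1) * n)
    rw [show (-(k : ℤ) - 1) * n + n = -k * n by ring, ih] at this
    push_cast at this ⊢; linarith

theorem intCast_le_mul_of_map_add_sub_le {F : ℤ → ℝ} {n : ℤ} {d : ℤ} {c : ℝ} (hn : 0 ≤ n)
    (hF : ∀ j, F (j + n) = F j + 1) (h : ∀ j, F (j + d) - F j ≤ c) : (d : ℝ) ≤ n * c := by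
  lift n to ℕ using hn
  have h1 : ∀ k : ℕ, F (k * d) ≤ F 0 + k * c := by
    intro k
    induction k with
    | zero => simp
    | succ k ih =>
      have := h (k * d)
      push_cast
      rw [show ((k : ℤ) + 1) * d = k * d + d by ring]
      linarith
  have h3 := h1 n
  rw [mul_comm, map_mul_of_map_add_eq_add_one hF] at h3
  push_cast; linarith

theorem eq_add_of_strictMono_of_map_add {b : ℤ → ℤ} {n : ℤ} (hn : 0 < n)
    (hb : ∀ j, b j < b (j + 1)) (hbn : ∀ j, b (j + n) = b j + n) (j : ℤ) : b j = j + b 0 := by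
  have h1 : ∀ (j : ℤ) (k : ℕ), b j + k ≤ b (j + k) := by
    intro j k
    induction k with
    | zero => simp
    | succ k ih =>
      have := hb (j + k)
      rw [Nat.cast_succ, ← add_assoc j]
      omega
  have h2 : ∀ j, b (j + 1) = b j + 1 := by
    intro j
    have h3 := h1 (j + 1) (n - 1).toNat
    have h4 := hbn j
    have h5 := hb j
    rw [Int.toNat_of_nonneg (by omega), show j + 1 + (n - 1) = j + n by ring] at h3
    omega
  induction j using Int.induction_on with
  | zero => simp
  | succ k ih => rw [h2, ih]; ring
  | pred k ih =>
    have := h2 (-(k : ℤ) - 1)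
    rw [show -(k : ℤ) - 1 + 1 = -k by ring] at this
    omega

theorem exists_farey_upper_neighbour {m n : ℤ} (hn : 1 < n) (h : IsCoprime m n) :
    ∃ m' r : ℤ, 0 < r ∧ r < n ∧ m' * n = 1 + m * r := by
  obtain ⟨a, c, hac⟩ := h
  have hdvd : n ∣ 1 + m * ((-a) % n) := by
    have h1 : n ∣ -a - (-a) % n := Int.dvd_self_sub_emod
    obtain ⟨d, hd⟩ := h1
    refine ⟨c - m * d, ?_⟩
    have : (-a) % n = -a - n * d := by omega
    rw [this]
    linear_combination -hac
  have hr0 : (-a) % n ≠ 0 := by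
    intro h0
    rw [h0, mul_zero, add_zero] at hdvd
    have := Int.le_of_dvd one_pos hdvd
    omega
  have := Int.emod_nonneg (-a) (by omega : n ≠ 0)
  obtain ⟨m', hm'⟩ := hdvd
  exact ⟨m', (-a) % n, by omega, Int.emod_lt_of_pos _ (by omega), by rw [hm']; ring⟩

/-- Think of two increasing sequences `z`, `w` of reals with `z (j + n) = z j + 1` and
`w (j + n) = w j + 1`; the map `b` records how they interleave: `b j` is the least `i` with
`z j ≤ w i`. The functions `u` and `v` are the values at `z` and `w` of semiconjugacies to the
translations by `s` and `t`. If `b` is not injective, then the configuration can be thinned out to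
one with a smaller period `r` and a larger rotation number `m' / r`. -/
theorem exists_div_le_of_interleaving (s t : ℝ) (N : ℕ) : ∀ (n m : ℤ), 0 < n → n ≤ N →
    IsCoprime m n → ∀ (b : ℤ → ℤ) (u v : ℤ → ℝ), Monotone b → Monotone u → Monotone v →
    (∀ j, b (j + n) = b j + n) → (∀ j, u (j + n) = u j + 1) → (∀ j, v (j + n) = v j + 1) →
    (∀ j, v j - v (b j) ≤ t) → (∀ j, u (b j - 1 + m) - u j ≤ s) →
    ∃ p₁ p₂ q : ℤ, 0 < q ∧ (p₁ : ℝ) / q ≤ s ∧ (p₂ : ℝ) / q ≤ t ∧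
      (m : ℝ) / n ≤ ((p₁ : ℝ) + p₂ + 1) / q := by
  induction N with
  | zero => intro n m h1 h2; simp at h2; omega
  | succ N ih =>
    intro n m hn hnN hmn b u v hb hu hv hbn hun hvn ht hs
    have hnR : (0 : ℝ) < n := by exact_mod_cast hn
    by_cases hstr : ∀ j, b j < b (j + 1)
    · have hbe := eq_add_of_strictMono_of_map_add hn hstr hbn
      have h1 := intCast_le_mul_of_map_add_sub_le (d := -b 0) hn.le hvn (c := t) (fun j => by
        have := ht (j + -b 0)
        rwa [hbe (j + -b 0), neg_add_cancel_right] at this)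
      have h2 := intCast_le_mul_of_map_add_sub_le (d := b 0 - 1 + m) hn.le hun (c := s) (fun j => by
        have := hs j
        rwa [hbe j, show j + b 0 - 1 + m = j + (b 0 - 1 + m) by ring] at this)
      refine ⟨b 0 - 1 + m, -b 0, n, hn, ?_, ?_, ?_⟩
      · rwa [div_le_iff₀' hnR]
      · rwa [div_le_iff₀' hnR]
      · apply le_of_eq; push_cast; ring
    · push Not at hstr
      obtain ⟨J, hJ⟩ := hstr
      have hJ' : b J = b (J + 1) := le_antisymm (hb (by omega)) hJ
      have hn1 : 1 < n := by
        by_contra hcon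
        obtain rfl : n = 1 := by omega
        have := hbn J
        omega
      obtain ⟨m', r, hr, hrn, hm'⟩ := exists_farey_upper_neighbour hn1 hmn
      have hrR : (0 : ℝ) < r := by exact_mod_cast hr
      have hcop : IsCoprime r n := ⟨-m, m', by linear_combination hm'⟩
      have hcop' : IsCoprime m' r := ⟨n, -m, by linear_combination hm'⟩
      set I : ℤ → ℤ := fun k => J + 1 + (n * k - 1) / r with hI
      set L : ℤ → ℤ := fun k => J + 1 + n * k / r with hL
      have hImono : Monotone I := fun x y hxy => by
        have h1 : n * x - 1 ≤ n * y - 1 := by gcongr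
        have := Int.ediv_le_ediv hr h1
        simp only [hI]; omega
      have hLmono : Monotone L := fun x y hxy => by
        have h1 : n * x ≤ n * y := by gcongr
        have := Int.ediv_le_ediv hr h1
        simp only [hL]; omega
      have hIr : ∀ k, I (k + r) = I k + n := fun k => by
        simp only [hI]
        rw [show n * (k + r) - 1 = n * k - 1 + n * r by ring, Int.add_mul_ediv_right _ _ hr.ne']
        ring
      have hLr : ∀ k, L (k + r) = L k + n := fun k => by
        simp only [hL]
        rw [show n * (k + r) = n * k + n * r by ring, Int.add_mul_ediv_right _ _ hr.ne']
        ring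
      have hLI : ∀ k, I (k + m') = L k + m := fun k => by
        simp only [hI, hL]
        rw [show n * (k + m') - 1 = n * k + m * r by linear_combination hm',
          Int.add_mul_ediv_right _ _ hr.ne']
        ring
      set B : ℤ → ℤ := fun k => -((-(r * (b (I k) - (J + 1)))) / n) with hB
      have hBmono : Monotone B := fun x y hxy => by
        have h1 := hb (hImono hxy)
        have h2 : -(r * (b (I y) - (J + 1))) ≤ -(r * (b (I x) - (J + 1))) := by gcongr
        have := Int.ediv_le_ediv hn h2
        simp only [hB]; omega
      have hBr : ∀ k, B (k + r) = B k + r := fun k => by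
        simp only [hB]
        rw [hIr, hbn, show -(r * (b (I k) + n - (J + 1))) = -(r * (b (I k) - (J + 1))) + -r * n by
          ring, Int.add_mul_ediv_right _ _ hn.ne']
        ring
      have hB1 : ∀ k, b (I k) ≤ L (B k) := fun k => by
        have h1 : b (I k) - (J + 1) ≤ n * B k / r := by
          rw [Int.le_ediv_iff_mul_le hr]
          have := Int.ediv_mul_le (-(r * (b (I k) - (J + 1)))) hn.ne'
          simp only [hB]
          linarith
        simp only [hL]; omega
      have hB2 : ∀ k, L (B k - 1) ≤ b (I k) - 1 := fun k => by
        have h1 : n * (B k - 1) / r < b (I k) - (J + 1) := by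
          rw [Int.ediv_lt_iff_lt_mul hr]
          have := Int.lt_ediv_add_one_mul_self (-(r * (b (I k) - (J + 1)))) hn
          simp only [hB]
          linarith
        simp only [hL]; omega
      have hLb : ∀ k, v (L k) - v (b (I k)) ≤ t := fun k => by
        by_cases hk : r ∣ k
        · obtain ⟨c, rfl⟩ := hk
          have hper : ∀ (c i : ℤ), b (i + n * c) = b i + n * c := by
            intro c i
            induction c using Int.induction_on with
            | zero => simp
            | succ c ih => rw [mul_add, mul_one, ← add_assoc, hbn, ih]; ring
            | pred c ih =>
              have := hbn (i + n * (-(c : ℤ) - 1))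
              rw [show i + n * (-(c : ℤ) - 1) + n = i + n * -c by ring, ih] at this
              linarith
          have h1 : L (r * c) = J + 1 + n * c := by
            simp only [hL]
            rw [show n * (r * c) = n * c * r by ring, Int.mul_ediv_cancel _ hr.ne']
          have h2 : I (r * c) = J + n * c := by
            simp only [hI]
            rw [show n * (r * c) - 1 = -1 + n * c * r by ring, Int.add_mul_ediv_right _ _ hr.ne',
              Int.ediv_eq_iff_of_pos hr |>.2 (by omega : -1 * r ≤ -1 ∧ -1 < -1 * r + r)]
            ring
          rw [h1, h2, hper, hJ', ← hper]
          exact ht _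
        · have hnk : ¬ r ∣ n * k := fun h => hk (hcop.dvd_of_dvd_mul_left h)
          have h1 : L k = I k := by
            simp only [hI, hL]
            congr 1
            have h3 := Int.emod_nonneg (n * k) hr.ne'
            have h4 : n * k % r ≠ 0 := fun h => hnk (Int.dvd_of_emod_eq_zero h)
            have h5 := Int.emod_lt_of_pos (n * k) hr
            have h6 := Int.mul_ediv_add_emod (n * k) r
            symm
            rw [Int.ediv_eq_iff_of_pos hr]
            constructor <;> nlinarith [lt_of_le_of_ne h3 h4.symm]
          rw [h1]; exact ht _
      obtain ⟨p₁, p₂, q, hq, h1, h2, h3⟩ := ih r m' hr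
        (by push_cast at hnN; omega) hcop' B (u ∘ I) (v ∘ L) hBmono
        (hu.comp hImono) (hv.comp hLmono) hBr (fun k => by simp [hIr, hun])
        (fun k => by simp [hLr, hvn])
        (fun k => by
          have h1 := hv (hB1 k)
          have h2 := hLb k
          simp only [Function.comp]; linarith)
        (fun k => by
          have h1 := hs (I k)
          have h2 := hu (add_le_add_left (hB2 k) m)
          simp only [Function.comp]
          rw [hLI]
          linarith)
      refine ⟨p₁, p₂, q, hq, h1, h2, le_trans ?_ h3⟩
      rw [div_le_div_iff₀ hnR hrR]
      have : (m' : ℝ) * n = 1 + m * r := by exact_mod_cast hm'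
      linarith

theorem translate_mul_apply (c : ℝ) (f : CircleDeg1Lift) (x : ℝ) :
    ((translate (Multiplicative.ofAdd c) : CircleDeg1Liftˣ) * f : CircleDeg1Lift) x = c + f x := by
  rw [mul_apply, translate_apply]

theorem continuous_translationNumber_translate_mul {f : CircleDeg1Lift} (hf : Continuous f) :
    Continuous fun c : ℝ =>
      translationNumber ((translate (Multiplicative.ofAdd c) : CircleDeg1Liftˣ) * f) := by
  set F : ℝ → CircleDeg1Lift := fun c => (translate (Multiplicative.ofAdd c) : CircleDeg1Liftˣ) * f
  have hcont : ∀ n : ℕ, Continuous fun c => (F c ^ n) 0 := by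
    intro n
    induction n with
    | zero => simpa using continuous_const
    | succ n ih =>
      have : (fun c => (F c ^ (n + 1)) 0) = fun c => c + f ((F c ^ n) 0) := by
        funext c
        rw [pow_succ', mul_apply, translate_mul_apply]
      rw [this]
      exact continuous_id.add (hf.comp ih)
  have hunif : TendstoUniformly (fun (n : ℕ) c => (F c ^ (n + 1)) 0 / ((n + 1 : ℕ) : ℝ))
      (fun c => translationNumber (F c)) Filter.atTop := by
    rw [Metric.tendstoUniformly_iff]
    intro ε hε
    filter_upwards [tendsto_one_div_add_atTop_nhds_zero_nat.eventually_lt_const hε] with n hn c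
    refine lt_of_le_of_lt ?_ hn
    have h := dist_pow_map_zero_mul_translationNumber_le (F c) (n + 1)
    have hpos : (0 : ℝ) < ((n + 1 : ℕ) : ℝ) := by positivity
    rw [dist_comm, Real.dist_eq] at *
    rw [show (F c ^ (n + 1)) 0 / ((n + 1 : ℕ) : ℝ) - translationNumber (F c) =
      ((F c ^ (n + 1)) 0 - ((n + 1 : ℕ) : ℝ) * translationNumber (F c)) / ((n + 1 : ℕ) : ℝ) by
        field_simp, abs_div, abs_of_pos hpos]
    push_cast at *
    gcongr
    rwa [abs_sub_comm]
  exact hunif.continuous (Filter.Frequently.of_forall fun n => (hcont (n + 1)).div_const _)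

theorem continuous_units (f : CircleDeg1Liftˣ) : Continuous (f : CircleDeg1Lift) := by
  rw [← coe_toOrderIso]; exact (toOrderIso f).continuous

theorem translationNumber_translate_mul_of_commute {c : ℝ} {f : CircleDeg1Lift}
    (h : ∀ x, f (c + x) = c + f x) :
    translationNumber ((translate (Multiplicative.ofAdd c) : CircleDeg1Liftˣ) * f) =
      c + translationNumber f := by
  rw [translationNumber_mul_of_commute, translationNumber_translate]
  refine CircleDeg1Lift.ext fun x => ?_
  simp [mul_apply, h]

theorem exists_translationNumber_translate_mul_eq (f : CircleDeg1Liftˣ) (x : ℝ) :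
    ∃ c, translationNumber ((translate (Multiplicative.ofAdd c) : CircleDeg1Liftˣ) *
      (f : CircleDeg1Lift)) = x := by
  have hint : ∀ n : ℤ, translationNumber ((translate (Multiplicative.ofAdd (n : ℝ)) :
      CircleDeg1Liftˣ) * (f : CircleDeg1Lift)) = n + translationNumber (f : CircleDeg1Lift) :=
    fun n => translationNumber_translate_mul_of_commute fun y => map_int_add _ _ _
  refine mem_range_of_exists_le_of_exists_ge
    (continuous_translationNumber_translate_mul (continuous_units f))
    ⟨((⌊x - translationNumber (f : CircleDeg1Lift)⌋ : ℤ) : ℝ), ?_⟩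
    ⟨((⌈x - translationNumber (f : CircleDeg1Lift)⌉ : ℤ) : ℝ), ?_⟩
  · rw [hint]
    linarith [Int.floor_le (x - translationNumber (f : CircleDeg1Lift))]
  · rw [hint]
    linarith [Int.le_ceil (x - translationNumber (f : CircleDeg1Lift))]

theorem exists_ge_translationNumber_eq (f : CircleDeg1Liftˣ) {x : ℝ}
    (h : translationNumber (f : CircleDeg1Lift) ≤ x) :
    ∃ g : CircleDeg1Liftˣ, (∀ y, f y ≤ g y) ∧ translationNumber (g : CircleDeg1Lift) = x := by
  rcases h.eq_or_lt with rfl | h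
  · exact ⟨f, fun _ => le_rfl, rfl⟩
  obtain ⟨c, hc⟩ := exists_translationNumber_translate_mul_eq f x
  refine ⟨translate (Multiplicative.ofAdd c) * f, fun y => ?_, by rwa [Units.val_mul]⟩
  rw [Units.val_mul, translate_mul_apply]
  by_contra! hcon
  have hle : (translate (Multiplicative.ofAdd c) : CircleDeg1Liftˣ) * (f : CircleDeg1Lift) ≤ f :=
    fun z => by
      rw [translate_mul_apply]
      linarith
  linarith [translationNumber_mono hle]

theorem exists_le_translationNumber_eq (f : CircleDeg1Liftˣ) {x : ℝ}
    (h : x ≤ translationNumber (f : CircleDeg1Lift)) :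
    ∃ g : CircleDeg1Liftˣ, (∀ y, g y ≤ f y) ∧ translationNumber (g : CircleDeg1Lift) = x := by
  obtain ⟨g, hg, hgx⟩ := exists_ge_translationNumber_eq f⁻¹ (x := -x)
    (by rw [translationNumber_units_inv]; linarith)
  refine ⟨g⁻¹, fun y => ?_, by rw [translationNumber_units_inv, hgx, neg_neg]⟩
  have h1 := (f : CircleDeg1Lift).monotone (hg (g⁻¹ y))
  rwa [units_apply_inv_apply, units_apply_inv_apply] at h1

theorem exists_unit_map_quarter : ∃ H : CircleDeg1Liftˣ, H 0 = 0 ∧ H (1 / 4) = 3 / 4 := by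
  set φ : ℝ → ℝ := fun y => 9 * y / (1 + 8 * y) with hφ
  set ψ : ℝ → ℝ := fun y => y / (9 - 8 * y) with hψ
  have hφm : ∀ x y, 0 ≤ x → x < y → φ x < φ y := fun x y hx hxy => by
    simp only [hφ]
    rw [div_lt_div_iff₀ (by linarith) (by linarith)]
    nlinarith
  have hφ0 : ∀ x, 0 ≤ x → 0 ≤ φ x := fun x hx => by simp only [hφ]; positivity
  have hφ1 : ∀ x, 0 ≤ x → x < 1 → φ x < 1 := fun x hx hx1 => by
    have := hφm x 1 hx hx1
    norm_num [hφ] at this ⊢; exact this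
  have hψ0 : ∀ y, 0 ≤ y → y < 1 → 0 ≤ ψ y ∧ ψ y < 1 ∧ φ (ψ y) = y := fun y hy hy1 => by
    have h9 : 0 < 9 - 8 * y := by linarith
    refine ⟨div_nonneg hy h9.le, (div_lt_one h9).2 (by linarith), ?_⟩
    have : 1 + 8 * (y / (9 - 8 * y)) = 9 / (9 - 8 * y) := by field_simp; ring
    simp only [hφ, hψ, this]
    field_simp
    rw [mul_comm y 8, mul_div_cancel_right₀ _ h9.ne']
  have hstr : StrictMono fun x : ℝ => ⌊x⌋ + φ (Int.fract x) := fun x y hxy => by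
    rcases (Int.floor_mono hxy.le).eq_or_lt with h | h
    · have : Int.fract x < Int.fract y := by
        rw [Int.fract, Int.fract, h]; linarith
      have := hφm _ _ (Int.fract_nonneg x) this
      simp only [h]; linarith
    · have h1 : (⌊x⌋ : ℝ) + 1 ≤ ⌊y⌋ := by exact_mod_cast h
      have h2 := hφ1 _ (Int.fract_nonneg x) (Int.fract_lt_one x)
      have h3 := hφ0 _ (Int.fract_nonneg y)
      simp only; linarith
  set H : CircleDeg1Lift := ⟨⟨fun x => ⌊x⌋ + φ (Int.fract x), hstr.monotone⟩, fun x => by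
    simp; ring⟩
  have hH : ∀ x, H x = ⌊x⌋ + φ (Int.fract x) := fun x => rfl
  have hunit : IsUnit H := by
    refine isUnit_iff_bijective.2 ⟨hstr.injective, fun y => ?_⟩
    obtain ⟨h0, h1, h2⟩ := hψ0 _ (Int.fract_nonneg y) (Int.fract_lt_one y)
    refine ⟨⌊y⌋ + ψ (Int.fract y), ?_⟩
    rw [hH, Int.floor_intCast_add, Int.fract_intCast_add, Int.floor_eq_zero_iff.2 ⟨h0, h1⟩,
      Int.fract_eq_self.2 ⟨h0, h1⟩, h2, add_zero, Int.floor_add_fract]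
  obtain ⟨U, hU⟩ := hunit
  refine ⟨U, by rw [hU, hH]; simp [hφ], ?_⟩
  rw [hU, hH, Int.floor_eq_zero_iff.2 (by norm_num), Int.fract_eq_self.2 (by norm_num)]
  norm_num [hφ]

theorem exists_unit_rescale (H : CircleDeg1Liftˣ) {q : ℤ} (hq : 0 < q) :
    ∃ h : CircleDeg1Liftˣ, ∀ x, h x = H (q * x) / q := by
  have hqR : (0 : ℝ) < q := by exact_mod_cast hq
  have hstr : Monotone fun x : ℝ => H (q * x) / q := fun x y hxy => by
    have := (H : CircleDeg1Lift).monotone (mul_le_mul_of_nonneg_left hxy hqR.le)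
    simp only; gcongr
  set h : CircleDeg1Lift := ⟨⟨fun x => H (q * x) / q, hstr⟩, fun x => by
    simp only [mul_add, mul_one, map_add_int]
    field_simp⟩
  have hh : ∀ x, h x = H (q * x) / q := fun x => rfl
  have hunit : IsUnit h := by
    refine isUnit_iff_bijective.2 ⟨fun x y hxy => ?_, fun y => ⟨H⁻¹ (q * y) / q, ?_⟩⟩
    · rw [hh, hh, div_left_inj' hqR.ne'] at hxy
      have := congrArg (H⁻¹ : CircleDeg1Liftˣ) hxy
      rw [units_inv_apply_apply, units_inv_apply_apply] at this
      exact mul_left_cancel₀ hqR.ne' this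
    · rw [hh, mul_div_cancel₀ _ hqR.ne', units_apply_inv_apply, mul_div_cancel_left₀ _ hqR.ne']
  obtain ⟨U, hU⟩ := hunit
  exact ⟨U, fun x => by rw [hU, hh]⟩

/-- Two lifts with translation numbers `p₁ / q` and `p₂ / q`, whose periodic orbits are placed half
way between each other, compose to a lift with translation number `(p₁ + p₂ + 1) / q`. -/
theorem exists_translationNumber_mul_ge {s t : ℝ} {p₁ p₂ q : ℤ} (hq : 0 < q)
    (h₁ : (p₁ : ℝ) / q ≤ s) (h₂ : (p₂ : ℝ) / q ≤ t) :
    ∃ f g : CircleDeg1Liftˣ, translationNumber (f : CircleDeg1Lift) = s ∧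
      translationNumber (g : CircleDeg1Lift) = t ∧
      ((p₁ : ℝ) + p₂ + 1) / q ≤ translationNumber ((f * g : CircleDeg1Liftˣ) : CircleDeg1Lift) := by
  have hqR : (0 : ℝ) < q := by exact_mod_cast hq
  obtain ⟨H, H0, H1⟩ := exists_unit_map_quarter
  obtain ⟨h, hh⟩ := exists_unit_rescale H hq
  have hcomm : ∀ (p : ℤ) (x : ℝ), h (p / q + x) = p / q + h x := fun p x => by
    rw [hh, hh, mul_add, mul_div_cancel₀ _ hqR.ne', map_int_add, add_div]
  have hτ : translationNumber (h : CircleDeg1Lift) = 0 := by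
    have := translationNumber_of_eq_add_int (f := (h : CircleDeg1Lift)) (x := 0) (m := 0)
      (by simp [hh, H0])
    simpa using this
  set e : ℝ := 1 / (2 * q) with he
  set T := translate (Multiplicative.ofAdd e) with hT
  set k : CircleDeg1Liftˣ := T * h * T⁻¹ with hk
  have hkx : ∀ x, k x = e + h (-e + x) := fun x => by
    simp only [hk, Units.val_mul, mul_apply, hT, translate_apply, translate_inv_apply]
  have hkcomm : ∀ (p : ℤ) (x : ℝ), k (p / q + x) = p / q + k x := fun p x => by
    rw [hkx, hkx, add_left_comm, hcomm]; ring
  have hkτ : translationNumber (k : CircleDeg1Lift) = 0 := by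
    rw [hk, Units.val_mul, Units.val_mul, translationNumber_conj_eq, hτ]
  clear_value k
  obtain ⟨f, hf, hfs⟩ := exists_ge_translationNumber_eq
    (translate (Multiplicative.ofAdd ((p₁ : ℝ) / q)) * h) (x := s) (by
      rwa [Units.val_mul, translationNumber_translate_mul_of_commute (hcomm _), hτ, add_zero])
  obtain ⟨g, hg, hgt⟩ := exists_ge_translationNumber_eq
    (translate (Multiplicative.ofAdd ((p₂ : ℝ) / q)) * k) (x := t) (by
      rwa [Units.val_mul, translationNumber_translate_mul_of_commute (hkcomm _), hkτ, add_zero])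
  refine ⟨f, g, hfs, hgt, ?_⟩
  set K : CircleDeg1Lift := (translate (Multiplicative.ofAdd (((-1 : ℤ) : ℝ) / q)) :
    CircleDeg1Liftˣ) * ((h : CircleDeg1Lift) * k) with hK
  have hKx : ∀ x, K x = ((-1 : ℤ) : ℝ) / q + h (k x) := fun x => by
    rw [hK, translate_mul_apply, mul_apply]
  have hKcomm : ∀ (p : ℤ) (x : ℝ), K (p / q + x) = p / q + K x := fun p x => by
    rw [hKx, hKx, hkcomm, hcomm]; ring
  have hKτ : translationNumber K = 0 := by
    have h1 : k (3 / (4 * q)) = ((1 : ℤ) : ℝ) / q + 1 / (4 * q) := by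
      rw [hkx, hh, show (q : ℝ) * (-e + 3 / (4 * q)) = 1 / 4 by rw [he]; field_simp; norm_num, H1,
        he]
      push_cast; field_simp; norm_num
    have h2 : K (3 / (4 * q)) = 3 / (4 * q) + ((0 : ℤ) : ℝ) := by
      rw [hKx, h1, hcomm, hh, show (q : ℝ) * (1 / (4 * q)) = 1 / 4 by field_simp, H1]
      push_cast; field_simp; norm_num
    simpa using translationNumber_of_eq_add_int K h2
  have hval := translationNumber_translate_mul_of_commute (hKcomm (p₁ + p₂ + 1))
  rw [hKτ, add_zero] at hval
  push_cast at hval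
  rw [← hval]
  refine translationNumber_mono fun x => ?_
  rw [translate_mul_apply, hKx, Units.val_mul, mul_apply]
  calc _ = (translate (Multiplicative.ofAdd ((p₁ : ℝ) / q)) * h : CircleDeg1Liftˣ)
        ((translate (Multiplicative.ofAdd ((p₂ : ℝ) / q)) * k : CircleDeg1Liftˣ) x) := by
        rw [Units.val_mul, Units.val_mul, translate_mul_apply, translate_mul_apply, hcomm]
        push_cast; ring
    _ ≤ _ := (hf _).trans ((f : CircleDeg1Lift).monotone (hg x))

theorem units_zpow_apply_of_apply_eq {P : CircleDeg1Liftˣ} {x : ℝ} (h : P x = x) (a : ℤ) :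
    (P ^ a) x = x := by
  induction a using Int.induction_on with
  | zero => simp
  | succ k ih => rw [zpow_add_one, Units.val_mul, mul_apply, h, ih]
  | pred k ih =>
    rw [zpow_sub_one, Units.val_mul, mul_apply]
    conv_lhs => rw [← h, units_inv_apply_apply]
    exact ih

/-- A periodic orbit of a lift `k` with translation number `m / n`, listed in increasing order. -/
theorem exists_monotone_periodic_orbit (k : CircleDeg1Liftˣ) {m : ℤ} {n : ℕ} (hn : 0 < n)
    (hmn : IsCoprime m n) (hk : translationNumber (k : CircleDeg1Lift) = m / n) :
    ∃ z : ℤ → ℝ, Monotone z ∧ (∀ l, z (l + n) = z l + 1) ∧ ∀ l, z (l + m) = k (z l) := by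
  obtain ⟨x, hx⟩ := (translationNumber_eq_rat_iff (f := (k : CircleDeg1Lift))
    (continuous_units k) hn).1 hk
  obtain ⟨a, b, hab⟩ := hmn
  set T : CircleDeg1Liftˣ := translate (Multiplicative.ofAdd 1) with hT
  have hTx : ∀ y, T y = y + 1 := fun y => by rw [hT, translate_apply, add_comm]
  have hTz : ∀ (c : ℤ) (y : ℝ), (T ^ c) y = y + c := fun c y => by
    rw [hT, translate_zpow, translate_apply, mul_one, add_comm]
  have hc : Commute k T := Units.ext <| CircleDeg1Lift.ext fun y => by
    rw [Units.val_mul, Units.val_mul, mul_apply, mul_apply, hTx, hTx, map_add_one]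
  have hcz : ∀ i j : ℤ, Commute (k ^ i) (T ^ j) := fun i j => hc.zpow_zpow i j
  set P : CircleDeg1Liftˣ := k ^ (n : ℤ) * T ^ (-m) with hP
  have hPx : P x = x := by
    rw [hP, (hcz _ _).eq, Units.val_mul, mul_apply, hTz, zpow_natCast, Units.val_pow_eq_pow_val, hx]
    push_cast; ring
  have hPz : ∀ c : ℤ, P ^ c = k ^ (n * c) * T ^ (-m * c) := fun c => by
    rw [hP, (hcz _ _).mul_zpow, zpow_mul, zpow_mul]
  set κ : CircleDeg1Liftˣ := k ^ a * T ^ b with hκ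
  have hκz : ∀ c : ℤ, κ ^ c = k ^ (a * c) * T ^ (b * c) := fun c => by
    rw [hκ, (hcz _ _).mul_zpow, zpow_mul, zpow_mul]
  have hκn : (κ ^ (n : ℤ)) x = x + 1 := by
    have : κ ^ (n : ℤ) = T * P ^ a := by
      rw [hκz, hPz, ← mul_assoc, ← zpow_one T, (hcz _ _).symm.eq, mul_assoc, zpow_one,
        ← zpow_one_add, mul_comm a, show b * (n : ℤ) = 1 + -m * a by linear_combination hab]
    rw [this, Units.val_mul, mul_apply, units_zpow_apply_of_apply_eq hPx, hTx]
  have hκm : (κ ^ m) x = k x := by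
    have : κ ^ m = k * P ^ (-b) := by
      rw [hκz, hPz, ← mul_assoc, ← zpow_one_add, show a * m = 1 + n * -b by linear_combination hab,
        show b * m = -m * -b by ring]
    rw [this, Units.val_mul, mul_apply, units_zpow_apply_of_apply_eq hPx]
  have hκx : x ≤ κ x := by
    have := (lt_iterate_pos_iff (κ : CircleDeg1Lift) (x := x) (m := 0) hn).1 (by
      rw [← coe_pow, ← Units.val_pow_eq_pow_val, ← zpow_natCast, hκn]; simp)
    simpa using this.le
  refine ⟨fun l => (κ ^ l) x, monotone_int_of_le_succ fun l => ?_, fun l => ?_, fun l => ?_⟩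
  · rw [zpow_add_one, Units.val_mul, mul_apply]
    exact CircleDeg1Lift.monotone _ hκx
  · beta_reduce
    rw [zpow_add, Units.val_mul, mul_apply, hκn, map_add_one]
  · have hcomm : Commute k (κ ^ l) := by
      refine Commute.zpow_right (Commute.mul_right ?_ ?_) l
      · exact (Commute.refl k).zpow_right a
      · exact hc.zpow_right b
    beta_reduce
    rw [zpow_add, Units.val_mul, mul_apply, hκm, ← mul_apply, ← mul_apply, ← Units.val_mul,
      ← Units.val_mul, hcomm.eq]

theorem exists_div_le_of_div_le_translationNumber_mul (f g : CircleDeg1Liftˣ) {m : ℤ} {n : ℕ}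
    (hn : 0 < n) (hmn : IsCoprime m n)
    (h : (m : ℝ) / n ≤ translationNumber ((f * g : CircleDeg1Liftˣ) : CircleDeg1Lift)) :
    ∃ p₁ p₂ q : ℤ, 0 < q ∧ (p₁ : ℝ) / q ≤ translationNumber (f : CircleDeg1Lift) ∧
      (p₂ : ℝ) / q ≤ translationNumber (g : CircleDeg1Lift) ∧
      (m : ℝ) / n ≤ ((p₁ : ℝ) + p₂ + 1) / q := by
  obtain ⟨k, hkfg, hk⟩ := exists_le_translationNumber_eq (f * g) h
  obtain ⟨z, hz, hzn, hzm⟩ := exists_monotone_periodic_orbit k hn hmn hk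
  have hsemi : ∀ φ : CircleDeg1Liftˣ, ∃ U : CircleDeg1Lift,
      ∀ x, U (φ x) = translationNumber (φ : CircleDeg1Lift) + U x := fun φ => by
    obtain ⟨U, hU⟩ := units_semiconj_of_translationNumber_eq (f₁ := φ)
      (f₂ := translate (Multiplicative.ofAdd (translationNumber (φ : CircleDeg1Lift))))
      (translationNumber_translate _).symm
    exact ⟨U, fun x => by rw [hU.eq, translate_apply]⟩
  obtain ⟨U, hU⟩ := hsemi f
  obtain ⟨V, hV⟩ := hsemi g
  set w : ℤ → ℝ := fun i => g (z i) with hw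
  have hwmono : Monotone w := (g : CircleDeg1Lift).monotone.comp hz
  have hwn : ∀ i, w (i + n) = w i + 1 := fun i => by simp only [hw]; rw [hzn, map_add_one]
  have hwc := map_mul_of_map_add_eq_add_one hwn
  have hleast : ∀ j, ∃ i, z j ≤ w i ∧ ∀ i', z j ≤ w i' → i ≤ i' := fun j => by
    refine Int.exists_least_of_bdd ⟨(⌈z j - w 0⌉ - 1) * n, fun i hi => ?_⟩ ⟨⌈z j - w 0⌉ * n, ?_⟩
    · by_contra! hlt
      have h1 := hwmono hlt.le
      rw [hwc] at h1
      have := Int.ceil_lt_add_one (z j - w 0)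
      push_cast at h1
      linarith
    · rw [hwc]
      linarith [Int.le_ceil (z j - w 0)]
  choose b hb1 hb2 using hleast
  have hb3 : ∀ j i, z j ≤ w i ↔ b j ≤ i := fun j i =>
    ⟨hb2 j i, fun hi => (hb1 j).trans (hwmono hi)⟩
  have hbn : ∀ j, b (j + n) = b j + n := fun j => by
    refine le_antisymm ((hb3 _ _).1 ?_) ?_
    · rw [hzn, hwn]; linarith [hb1 j]
    · rw [← le_sub_iff_add_le]
      refine (hb3 _ _).1 ?_
      have h1 := hb1 (j + n)
      have h2 := hwn (b (j + n) - n)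
      rw [sub_add_cancel] at h2
      rw [hzn] at h1
      linarith
  have := exists_div_le_of_interleaving (translationNumber (f : CircleDeg1Lift))
    (translationNumber (g : CircleDeg1Lift)) n n m (by exact_mod_cast hn) le_rfl hmn b
    (fun i => U (z i)) (fun i => V (w i))
    (fun i j hij => (hb3 _ _).1 ((hz hij).trans (hb1 j)))
    (U.monotone.comp hz) (V.monotone.comp hwmono) hbn
    (fun j => by rw [hzn, map_add_one]) (fun j => by rw [hwn, map_add_one])
    (fun j => by
      have := V.monotone (hb1 j)
      simp only [hw] at this ⊢
      rw [hV (z j)]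
      linarith)
    (fun j => by
      have h1 : w (b j - 1) ≤ z j := by
        refine (lt_of_not_ge fun hle => ?_).le
        have := (hb3 _ _).1 hle
        omega
      have h2 := hkfg (z (b j - 1))
      rw [Units.val_mul, mul_apply] at h2
      have h3 := U.monotone h2
      rw [hU] at h3
      have h4 := U.monotone h1
      rw [hzm]
      simp only [hw] at h4
      linarith)
  exact_mod_cast this

/-- The Calegari–Walker formula for products: for all `s, t ∈ ℝ`,
`R_{fg}(s,t) = sup { (p₁+p₂+1)/q : p₁, p₂, q ∈ ℤ, q > 0, p₁/q ≤ s, p₂/q ≤ t }`. -/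
theorem Rfg_formula (s t : ℝ) :
    sSup {y : ℝ | ∃ f g : CircleDeg1Liftˣ,
        translationNumber (f : CircleDeg1Lift) = s ∧
        translationNumber (g : CircleDeg1Lift) = t ∧
        y = translationNumber ((f * g : CircleDeg1Liftˣ) : CircleDeg1Lift)} =
      sSup {y : ℝ | ∃ p₁ p₂ q : ℤ, 0 < q ∧ (p₁ : ℝ) / q ≤ s ∧ (p₂ : ℝ) / q ≤ t ∧
        y = ((p₁ : ℝ) + p₂ + 1) / q} := by
  set A := {y : ℝ | ∃ f g : CircleDeg1Liftˣ, translationNumber (f : CircleDeg1Lift) = s ∧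
    translationNumber (g : CircleDeg1Lift) = t ∧
    y = translationNumber ((f * g : CircleDeg1Liftˣ) : CircleDeg1Lift)} with hA
  set B := {y : ℝ | ∃ p₁ p₂ q : ℤ, 0 < q ∧ (p₁ : ℝ) / q ≤ s ∧ (p₂ : ℝ) / q ≤ t ∧
    y = ((p₁ : ℝ) + p₂ + 1) / q} with hB
  have hBne : B.Nonempty := ⟨_, ⌊s⌋, ⌊t⌋, 1, one_pos, by simpa using Int.floor_le s,
    by simpa using Int.floor_le t, rfl⟩
  have hAne : A.Nonempty := ⟨_, translate (Multiplicative.ofAdd s),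
    translate (Multiplicative.ofAdd t), translationNumber_translate s,
    translationNumber_translate t, rfl⟩
  have hBbdd : BddAbove B := by
    refine ⟨s + t + 1, ?_⟩
    rintro y ⟨p₁, p₂, q, hq, h1, h2, rfl⟩
    have : (1 : ℝ) / q ≤ 1 := by
      rw [div_le_one (by exact_mod_cast hq)]
      exact_mod_cast hq
    rw [add_div, add_div]
    linarith
  have hAB : ∀ y ∈ A, y ≤ sSup B := by
    rintro y ⟨f, g, rfl, rfl, rfl⟩
    refine le_of_forall_rat_lt_imp_le fun r hr => ?_
    have hrR : ((r.num : ℤ) : ℝ) / (r.den : ℕ) = r := by exact_mod_cast r.num_div_den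
    obtain ⟨p₁, p₂, q, hq, h1, h2, h3⟩ := exists_div_le_of_div_le_translationNumber_mul f g
      r.den_pos (Rat.isCoprime_num_den r) (hrR.trans_le hr.le)
    rw [hrR] at h3
    exact h3.trans (le_csSup hBbdd ⟨p₁, p₂, q, hq, h1, h2, rfl⟩)
  refine le_antisymm (csSup_le hAne hAB) (csSup_le hBne ?_)
  rintro y ⟨p₁, p₂, q, hq, h1, h2, rfl⟩
  obtain ⟨f, g, hf, hg, h3⟩ := exists_translationNumber_mul_ge hq h1 h2
  exact h3.trans (le_csSup ⟨_, hAB⟩ ⟨f, g, hf, hg, rfl⟩)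
end
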